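/- arXiv:1201.1137 — 4 statements merged into one kernel-verified Lean document; each statement's English description precedes it below -/
import Mathlib

section
/- Let K be a field and A ∈ GL_n(K[t]) such that its minimal polynomial g(X) over K(t) is an irreducible polynomial in K[X] of degree d ≥ 1. Then: (1) if g is separable over K, A is conjugate over K[t] (by a matrix in GL_n(K[t])) to the n×n block diagonal matrix consisting of n/d copies of the companion matrix of g; (2) if d = n, then A is conjugate over K[t] to the companion matrix of g. -/
/-- The companion matrix of a (monic) polynomial
`g = X^d + c_{d-1} X^{d-1} + ⋯ + c_0`: 1's on the subdiagonal, last column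
`(-c_0, …, -c_{d-1})ᵀ`, zeros elsewhere. -/
def companionMatrix {K : Type*} [CommRing K] (g : Polynomial K) :
    Matrix (Fin g.natDegree) (Fin g.natDegree) K :=
  Matrix.of fun i j =>
    if (i : ℕ) = (j : ℕ) + 1 then 1
    else if (j : ℕ) = g.natDegree - 1 then -g.coeff (i : ℕ) else 0

open Polynomial in
theorem PowerBasis.minpolyGen_eq_of_natDegree_eq_dim {R S : Type*} [CommRing R] [CommRing S]
    [Algebra R S] (pb : PowerBasis R S) {h : R[X]} (hm : h.Monic)
    (hroot : aeval pb.gen h = 0) (hdeg : h.natDegree = pb.dim) : pb.minpolyGen = h := by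
  nontriviality R
  by_contra hne
  have hlt : (pb.minpolyGen - h).degree < pb.minpolyGen.degree := by
    refine degree_sub_lt_left ?_ pb.minpolyGen_monic.ne_zero ?_
    · rw [pb.degree_minpolyGen, degree_eq_natDegree hm.ne_zero, hdeg]
    · rw [pb.minpolyGen_monic.leadingCoeff, hm.leadingCoeff]
  rw [pb.degree_minpolyGen] at hlt
  refine (pb.dim_le_degree_of_root (sub_ne_zero.mpr hne) ?_).not_gt hlt
  rw [map_sub, pb.aeval_minpolyGen, hroot, sub_zero]

open Polynomial in
theorem PowerBasis.leftMulMatrix_reindex_eq_companionMatrix_map {K R S : Type*} [CommRing K]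
    [CommRing R] [CommRing S] [Algebra R S] [Nontrivial R] (φ : K →+* R) (pb : PowerBasis R S)
    {g : K[X]} (hg : g.Monic) (hroot : aeval pb.gen (g.map φ) = 0) (hd : pb.dim = g.natDegree) :
    Algebra.leftMulMatrix (pb.basis.reindex (finCongr hd)) pb.gen =
      (companionMatrix g).map φ := by
  have hgen : pb.minpolyGen = g.map φ :=
    pb.minpolyGen_eq_of_natDegree_eq_dim (hg.map φ) hroot (by rw [hg.natDegree_map, hd])
  ext i j
  have hreindex : Algebra.leftMulMatrix (pb.basis.reindex (finCongr hd)) pb.gen i j =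
      Algebra.leftMulMatrix pb.basis pb.gen ((finCongr hd).symm i) ((finCongr hd).symm j) := by
    simp [Algebra.leftMulMatrix_eq_repr_mul]
  have hi := i.2
  have hj := j.2
  rw [hreindex, PowerBasis.leftMulMatrix, hgen, companionMatrix, Matrix.map_apply,
    Matrix.of_apply, Matrix.of_apply]
  simp only [finCongr_symm, finCongr_apply, Fin.val_cast, coeff_map, hd]
  split_ifs <;> first | omega | simp

open Polynomial in
/-- `K[t][X] / (g) ≃ (K[X] / (g))[t]` for `g ∈ K[X]`. -/
noncomputable def AdjoinRoot.mapCEquiv {K : Type*} [CommRing K] (g : K[X]) :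
    AdjoinRoot (g.map (C : K →+* K[X])) ≃+* (AdjoinRoot g)[X] :=
  have toPoly : (g.map (C : K →+* K[X])).eval₂ (mapRingHom (AdjoinRoot.of g))
      (C (AdjoinRoot.root g)) = 0 := by
    have hc : (mapRingHom (AdjoinRoot.of g)).comp C = C.comp (AdjoinRoot.of g) := by
      ext; simp
    rw [eval₂_map, hc, ← hom_eval₂, AdjoinRoot.eval₂_root, map_zero]
  have ofPoly : g.eval₂ ((AdjoinRoot.of (g.map (C : K →+* K[X]))).comp C)
      (AdjoinRoot.root (g.map (C : K →+* K[X]))) = 0 := by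
    have hr := AdjoinRoot.eval₂_root (g.map (C : K →+* K[X]))
    rwa [eval₂_map] at hr
  RingEquiv.ofRingHom (AdjoinRoot.lift _ _ toPoly)
    (eval₂RingHom (AdjoinRoot.lift _ _ ofPoly) (AdjoinRoot.of _ X))
    (Polynomial.ringHom_ext' (AdjoinRoot.ringHom_ext (by ext x; simp) (by simp)) (by simp))
    (AdjoinRoot.ringHom_ext (Polynomial.ringHom_ext' (by ext x; simp) (by simp)) (by simp))

theorem Module.IsTorsionFree.of_isIntegral {R S M : Type*} [CommRing R] [IsDomain R] [CommRing S]
    [IsDomain S] [Algebra R S] [Algebra.IsIntegral R S] [AddCommGroup M] [Module R M] [Module S M]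
    [IsScalarTower R S M] [Module.IsTorsionFree R M] : Module.IsTorsionFree S M := by
  refine ⟨fun s hs => isSMulRegular_iff_right_eq_zero_of_smul.mpr fun x hx => ?_⟩
  obtain ⟨r, hr, c, hc⟩ := (Algebra.IsIntegral.isIntegral (R := R) s).isAlgebraic.exists_nonzero_dvd
    (mem_nonZeroDivisors_of_ne_zero hs.ne_zero)
  have : r • x = 0 := by
    rw [← algebraMap_smul S r x, hc, mul_comm, mul_smul, hx, smul_zero]
  exact (smul_eq_zero.mp this).resolve_left hr

open Polynomial in
theorem LinearMap.exists_basis_toMatrix_eq_blockDiagonal_companionMatrix {K M : Type*} [Field K]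
    [AddCommGroup M] [Module K[X] M] [Module.Finite K[X] M] [Module.IsTorsionFree K[X] M]
    (f : Module.End K[X] M) {g : K[X]} (hg : g.Monic) (hirr : Irreducible g)
    (hf : aeval f (g.map (C : K →+* K[X])) = 0) :
    ∃ (r : ℕ) (b : Module.Basis (Fin g.natDegree × Fin r) K[X] M),
      LinearMap.toMatrix b b f =
        Matrix.blockDiagonal fun _ : Fin r => (companionMatrix g).map (C : K →+* K[X]) := by
  have := Fact.mk hirr
  let h := g.map (C : K →+* K[X])
  have hm : h.Monic := hg.map C
  let e := AdjoinRoot.mapCEquiv g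
  have : IsDomain (AdjoinRoot h) := e.toMulEquiv.isDomain _
  have : IsPrincipalIdealRing (AdjoinRoot h) :=
    IsPrincipalIdealRing.of_surjective e.symm.toRingHom e.symm.surjective
  let φ : AdjoinRoot h →ₐ[K[X]] Module.End K[X] M :=
    Ideal.Quotient.liftₐ (Ideal.span {h}) (aeval f) fun a ha => by
      obtain ⟨c, rfl⟩ := Ideal.mem_span_singleton.mp ha
      rw [map_mul, hf, zero_mul]
  let : Module (AdjoinRoot h) M := Module.compHom M φ.toRingHom
  have hsmul (s : AdjoinRoot h) (x : M) : s • x = φ s x := rfl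
  have : IsScalarTower K[X] (AdjoinRoot h) M :=
    ⟨fun r s x => by rw [hsmul, hsmul, map_smul]; rfl⟩
  have hroot (x : M) : f x = AdjoinRoot.root h • x := by
    have : φ (AdjoinRoot.root h) = aeval f X := rfl
    rw [hsmul, this, aeval_X]
  let pb := AdjoinRoot.powerBasis' hm
  have : Module.Finite K[X] (AdjoinRoot h) := pb.finite
  have : Module.IsTorsionFree (AdjoinRoot h) M := .of_isIntegral (R := K[X])
  have : Module.Finite (AdjoinRoot h) M := .of_restrictScalars_finite K[X] _ _
  obtain ⟨r, b⟩ := Module.basisOfFiniteTypeTorsionFree' (R := AdjoinRoot h) (M := M)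
  have hgen : pb.gen = AdjoinRoot.root h := AdjoinRoot.powerBasis'_gen hm
  have hd : pb.dim = g.natDegree := hg.natDegree_map C
  refine ⟨r, (pb.basis.reindex (finCongr hd)).smulTower b, ?_⟩
  have hgen0 : aeval pb.gen h = 0 := by
    rw [hgen, AdjoinRoot.aeval_eq, AdjoinRoot.mk_self]
  rw [← pb.leftMulMatrix_reindex_eq_companionMatrix_map C hg hgen0 hd]
  ext1 ⟨i, k⟩ ⟨j, l⟩
  rw [LinearMap.toMatrix_apply, Module.Basis.smulTower_repr, Module.Basis.smulTower_apply, hroot,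
    smul_smul, map_smul, Matrix.blockDiagonal_apply, Algebra.leftMulMatrix_eq_repr_mul, hgen]
  by_cases hkl : k = l
  · subst hkl
    simp
  · simp [hkl]

open Polynomial in
theorem Matrix.exists_isUnit_mul_eq_blockDiagonal_companionMatrix {K : Type*} [Field K] {n : ℕ}
    (A : Matrix (Fin n) (Fin n) K[X]) {g : K[X]} (hg : g.Monic) (hirr : Irreducible g)
    (hA : aeval A (g.map (C : K →+* K[X])) = 0) :
    ∃ r, n = g.natDegree * r ∧ ∀ e : Fin g.natDegree × Fin r ≃ Fin n,
      ∃ B : Matrix (Fin n) (Fin n) K[X], IsUnit B ∧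
        B * A = Matrix.reindex e e (Matrix.blockDiagonal fun _ : Fin r =>
          (companionMatrix g).map (C : K →+* K[X])) * B := by
  obtain ⟨r, b, hb⟩ :=
    LinearMap.exists_basis_toMatrix_eq_blockDiagonal_companionMatrix (Matrix.toLinAlgEquiv' A)
      hg hirr (by rw [← AlgEquiv.coe_toAlgHom, aeval_algHom_apply, hA, map_zero])
  refine ⟨r, ?_, fun e => ?_⟩
  · simpa using (Module.finrank_eq_card_basis b)
  let b' := b.reindex e
  let s := Pi.basisFun K[X] (Fin n)
  refine ⟨b'.toMatrix s, ⟨⟨b'.toMatrix s, s.toMatrix b', ?_, ?_⟩, rfl⟩, ?_⟩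
  · exact b'.toMatrix_mul_toMatrix_flip s
  · exact s.toMatrix_mul_toMatrix_flip b'
  · have hb' : LinearMap.toMatrix b' b' (Matrix.toLin' A) = Matrix.reindex e e
        (Matrix.blockDiagonal fun _ : Fin r => (companionMatrix g).map (C : K →+* K[X])) := by
      rw [← hb]
      ext i j
      simp [LinearMap.toMatrix_apply, b', Matrix.toLinAlgEquiv'_apply]
    have hs : LinearMap.toMatrix s s (Matrix.toLin' A) = A := LinearMap.toMatrix'_toLin' A
    rw [← hb']
    conv_lhs => rw [← hs]
    rw [basis_toMatrix_mul_linearMap_toMatrix, linearMap_toMatrix_mul_basis_toMatrix]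

/-- Let `A ∈ GL_n(K[t])` whose minimal polynomial over `K(t)` is
(the image of) an irreducible `g ∈ K[X]` of degree `d ≥ 1`. Then:
(1) if `g` is separable, `A` is conjugate over `K[t]` to the block diagonal matrix
consisting of `n/d` copies of the companion matrix of `g`;
(2) if `d = n`, then `A` is conjugate over `K[t]` to the companion matrix of `g`. -/
theorem statement_11 (K : Type*) [Field K] (n : ℕ)
    (A : Matrix (Fin n) (Fin n) (Polynomial K)) (hA : IsUnit A)
    (g : Polynomial K) (hgmonic : g.Monic) (hgirr : Irreducible g)
    (hgdeg : 1 ≤ g.natDegree)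
    (hming : minpoly (RatFunc K) (A.map (algebraMap (Polynomial K) (RatFunc K))) =
      g.map (algebraMap K (RatFunc K))) :
    (g.Separable →
      ∃ (e : (Fin g.natDegree × Fin (n / g.natDegree)) ≃ Fin n)
        (B : Matrix (Fin n) (Fin n) (Polynomial K)),
        IsUnit B ∧
        B * A = (Matrix.reindex e e (Matrix.blockDiagonal
          (fun _ : Fin (n / g.natDegree) =>
            (companionMatrix g).map (algebraMap K (Polynomial K))))) * B) ∧
    (g.natDegree = n →
      ∃ (e : Fin g.natDegree ≃ Fin n) (B : Matrix (Fin n) (Fin n) (Polynomial K)),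
        IsUnit B ∧
        B * A = (Matrix.reindex e e
          ((companionMatrix g).map (algebraMap K (Polynomial K)))) * B) := by
  have hroot : Polynomial.aeval A (g.map (Polynomial.C : K →+* Polynomial K)) = 0 := by
    let ψ := (Algebra.ofId (Polynomial K) (RatFunc K)).mapMatrix (m := Fin n)
    have hψ : Function.Injective ψ :=
      Matrix.map_injective (IsFractionRing.injective (Polynomial K) (RatFunc K))
    refine hψ ?_
    have h0 := minpoly.aeval (RatFunc K) (A.map (algebraMap (Polynomial K) (RatFunc K)))
    rw [hming, Polynomial.aeval_map_algebraMap] at h0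
    rw [map_zero, ← Polynomial.aeval_algHom_apply, ← Polynomial.algebraMap_eq,
      Polynomial.aeval_map_algebraMap]
    exact h0
  obtain ⟨r, hr, key⟩ :=
    Matrix.exists_isUnit_mul_eq_blockDiagonal_companionMatrix A hgmonic hgirr hroot
  obtain rfl : n / g.natDegree = r := by
    rw [hr, Nat.mul_div_cancel_left r hgdeg]
  refine ⟨fun _ => ?_, fun hn => ?_⟩
  · let e := finProdFinEquiv.trans (finCongr hr.symm)
    exact ⟨e, key e⟩
  · have h1 : n / g.natDegree = 1 := by rw [hn, Nat.div_self (hn ▸ hgdeg)]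
    have : Unique (Fin (n / g.natDegree)) := (finCongr h1).unique
    let p : Fin g.natDegree × Fin (n / g.natDegree) ≃ Fin g.natDegree := Equiv.prodUnique _ _
    obtain ⟨B, hB, h⟩ := key (p.trans (finCongr hn))
    refine ⟨finCongr hn, B, hB, h.trans ?_⟩
    congr 1
    ext i j
    simp [Matrix.blockDiagonal_apply, p, Polynomial.algebraMap_eq]
end

section
/- Let K be a field and A ∈ GL_n(K[t]) a matrix satisfying A^d = I_n for some positive integer d not divisible by the characteristic of K. Then there exists B ∈ GL_n(K[t]) such that B^{−1}AB ∈ GL_n(K), i.e. A is conjugate over K[t] to a matrix with entries in K. -/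
open Polynomial

universe u

/-- The quotient `K[t][x] ⧸ (p(x))` is a polynomial ring in `t` over `K[x] ⧸ (p)`. -/
noncomputable def AdjoinRoot.mapCEquivPolynomial {K : Type*} [CommRing K] (p : K[X]) :
    AdjoinRoot (p.map (C : K →+* K[X])) ≃+* (AdjoinRoot p)[X] :=
  (Ideal.quotientEquiv _ ((Ideal.span {p}).map (C : K[X] →+* K[X][X]))
    (Bivariate.swap (R := K)).toRingEquiv
    (by
      rw [Ideal.map_span, Ideal.map_span]
      simp only [Set.image_singleton]
      congr 2
      exact (Bivariate.swap_map_C p).symm)).trans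
    (Ideal.polynomialQuotientEquivQuotientPolynomial (Ideal.span {p})).symm

theorem AdjoinRoot.isDomain_map_C {K : Type*} [Field K] {p : K[X]} (hp : Irreducible p) :
    IsDomain (AdjoinRoot (p.map (C : K →+* K[X]))) :=
  have := Fact.mk hp
  (AdjoinRoot.mapCEquivPolynomial p).toMulEquiv.isDomain _

theorem AdjoinRoot.isPrincipalIdealRing_map_C {K : Type*} [Field K] {p : K[X]}
    (hp : Irreducible p) : IsPrincipalIdealRing (AdjoinRoot (p.map (C : K →+* K[X]))) :=
  have := Fact.mk hp
  .of_surjective (AdjoinRoot.mapCEquivPolynomial p).symm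
    (AdjoinRoot.mapCEquivPolynomial p).symm.surjective

theorem AdjoinRoot.powerBasisAux'_repr_root_mul_mem {K : Type*} [Field K] {p : K[X]}
    (hp : p.Monic) (i j : Fin (p.map (C : K →+* K[X])).natDegree) :
    (powerBasisAux' (hp.map C)).repr (root _ * powerBasisAux' (hp.map C) j) i
      ∈ Set.range (C : K → K[X]) := by
  have h : powerBasisAux' (hp.map (C : K →+* K[X])) j = root _ ^ (j : ℕ) :=
    (powerBasis' (hp.map C)).basis_eq_pow j
  rw [h, ← pow_succ', ← mk_X, ← map_pow, powerBasisAux'_repr_apply_to_fun, modByMonicHom_mk,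
    ← Polynomial.map_X (C : K →+* K[X]), ← Polynomial.map_pow, ← map_modByMonic _ hp, coeff_map]
  exact ⟨_, rfl⟩

theorem Module.IsTorsionFree.of_isAlgebraic {R S N : Type*} [CommRing R] [IsDomain R] [CommRing S]
    [IsDomain S] [Algebra R S] [Algebra.IsAlgebraic R S] [AddCommGroup N]
    [Module R N] [Module S N] [IsScalarTower R S N] [Module.IsTorsionFree R N] :
    Module.IsTorsionFree S N := by
  refine .of_smul_eq_zero fun s x h => or_iff_not_imp_left.mpr fun hs => ?_
  obtain ⟨b, a, ha, hb⟩ := (Algebra.IsAlgebraic.isAlgebraic (R := R) s).exists_smul_eq_mul 1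
    (mem_nonZeroDivisors_of_ne_zero hs)
  have : a • x = 0 := by
    rw [← one_smul S x, ← smul_assoc, hb, mul_comm, mul_smul, h, smul_zero]
  exact (smul_eq_zero_iff_right ha).mp this

/-- A finite torsion-free `K[t]`-module with an endomorphism `x` killed by a monic irreducible
polynomial over `K` has a basis in which `x` has entries in `K`. -/
theorem exists_basis_repr_X_smul_mem_of_irreducible {K N : Type*} [Field K] [AddCommGroup N]
    [Module K[X] N] [Module K[X][X] N] [IsScalarTower K[X] K[X][X] N]
    [Module.Finite K[X] N] [Module.IsTorsionFree K[X] N] {p : K[X]} (hp : Irreducible p)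
    (hpm : p.Monic) (hN : Module.IsTorsionBy K[X][X] N (p.map C)) :
    ∃ (a m : ℕ) (b : Module.Basis (Fin a × Fin m) K[X] N),
      ∀ i j, b.repr ((X : K[X][X]) • b j) i ∈ Set.range (C : K → K[X]) := by
  have hNs : Module.IsTorsionBySet K[X][X] N (Ideal.span {p.map (C : K →+* K[X])}) :=
    (Module.isTorsionBySet_span_singleton_iff _).mpr hN
  let : Module (AdjoinRoot (p.map (C : K →+* K[X]))) N := hNs.module
  have : IsScalarTower K[X] (AdjoinRoot (p.map (C : K →+* K[X]))) N := hNs.isScalarTower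
  have := AdjoinRoot.isDomain_map_C hp
  have := AdjoinRoot.isPrincipalIdealRing_map_C hp
  let c := AdjoinRoot.powerBasisAux' (hpm.map (C : K →+* K[X]))
  have : Module.Finite K[X] (AdjoinRoot (p.map (C : K →+* K[X]))) := .of_basis c
  have : Module.Finite (AdjoinRoot (p.map (C : K →+* K[X]))) N :=
    .of_restrictScalars_finite K[X] _ _
  have : Module.IsTorsionFree (AdjoinRoot (p.map (C : K →+* K[X]))) N :=
    .of_isAlgebraic (R := K[X])
  let e := Module.finBasis (AdjoinRoot (p.map (C : K →+* K[X]))) N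
  refine ⟨_, _, c.smulTower e, ?_⟩
  rintro ⟨i, k⟩ ⟨j, l⟩
  have hX : (X : K[X][X]) • (c j • e l) =
      (AdjoinRoot.root (p.map (C : K →+* K[X])) * c j) • e l := by
    rw [mul_smul]; rfl
  rw [Module.Basis.smulTower_apply, hX, Module.Basis.smulTower_repr, map_smul,
    Module.Basis.repr_self, Finsupp.smul_apply, Finsupp.single_apply]
  split_ifs
  · rw [smul_eq_mul, mul_one]
    exact AdjoinRoot.powerBasisAux'_repr_root_mul_mem hpm i j
  · exact ⟨0, by simp⟩

/-- A finite torsion-free `K[t]`-module with an endomorphism `x` killed by a squarefree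
polynomial over `K` has a basis in which `x` has entries in `K`. -/
theorem exists_basis_repr_X_smul_mem_of_squarefree {K : Type u} {N : Type*} [Field K]
    [AddCommGroup N] [Module K[X] N] [Module K[X][X] N] [IsScalarTower K[X] K[X][X] N]
    [Module.Finite K[X] N] [Module.IsTorsionFree K[X] N] {q : K[X]} (hq : Squarefree q)
    (hN : Module.IsTorsionBy K[X][X] N (q.map C)) :
    ∃ (ι : Type u) (_ : Finite ι) (b : Module.Basis ι K[X] N),
      ∀ i j, b.repr ((X : K[X][X]) • b j) i ∈ Set.range (C : K → K[X]) := by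
  classical
  have hq0 : q ≠ 0 := hq.ne_zero
  let S := (UniqueFactorizationMonoid.normalizedFactors q).toFinset
  have hirr (p) (hp : p ∈ S) : Irreducible p :=
    UniqueFactorizationMonoid.irreducible_of_normalized_factor p (Multiset.mem_toFinset.mp hp)
  have hmon (p) (hp : p ∈ S) : p.Monic := by
    have := UniqueFactorizationMonoid.normalize_normalized_factor p (Multiset.mem_toFinset.mp hp)
    rw [← this]
    exact monic_normalize (hirr p hp).ne_zero
  have hprod : Associated (∏ p ∈ S, p) q := by
    rw [Finset.prod_eq_multiset_prod, Multiset.toFinset_val, Multiset.map_id',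
      ((UniqueFactorizationMonoid.squarefree_iff_nodup_normalizedFactors hq0).mp hq).dedup]
    exact UniqueFactorizationMonoid.prod_normalizedFactors hq0
  have hcop (p) (hp : p ∈ S) (p') (hp' : p' ∈ S) (hne : p ≠ p') : IsCoprime p p' :=
    (hirr p hp).coprime_iff_not_dvd.mpr fun h => hne <|
      eq_of_monic_of_associated (hmon p hp) (hmon p' hp')
        ((hirr p hp).associated_of_dvd (hirr p' hp') h)
  let T (p : K[X]) : Submodule K[X][X] N := Submodule.torsionBy K[X][X] N (p.map C)
  have hint' : DirectSum.IsInternal fun p : S => T p := by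
    refine Submodule.torsionBy_isInternal (R := K[X][X]) (M := N) (S := S)
      (q := fun p : K[X] => p.map C) ?_ ?_
    · intro p hp p' hp' hne
      exact (hcop p hp p' hp' hne).map (mapRingHom C)
    · obtain ⟨u, hu⟩ := hprod.symm
      intro x
      rw [← Polynomial.map_prod, ← hu, Polynomial.map_mul, mul_comm, mul_smul, hN, smul_zero]
  have hint : DirectSum.IsInternal fun p : S => (T p).restrictScalars K[X] := hint'
  have hT (p : S) : ∃ (a m : ℕ)
      (b : Module.Basis (Fin a × Fin m) K[X] ((T p).restrictScalars K[X])),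
      ∀ i j, b.repr ⟨(X : K[X][X]) • (b j : N), (T p).smul_mem _ (b j).2⟩ i
        ∈ Set.range (C : K → K[X]) := by
    exact exists_basis_repr_X_smul_mem_of_irreducible (N := (T p).restrictScalars K[X])
      (hirr p p.2) (hmon p p.2) (Submodule.torsionBy_isTorsionBy _)
  choose a m b hb using hT
  refine ⟨_, inferInstance, hint.collectedBasis b, ?_⟩
  rintro ⟨p, i⟩ ⟨p', j⟩
  rw [DirectSum.IsInternal.collectedBasis_coe]
  have hmem : (X : K[X][X]) • (b p' j : N) ∈ (T p').restrictScalars K[X] :=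
    (T p').smul_mem _ (b p' j).2
  by_cases h : p' = p
  · subst h
    rw [hint.collectedBasis_repr_of_mem b hmem]
    exact hb p' i j
  · rw [hint.collectedBasis_repr_of_mem_ne b h hmem]
    exact ⟨0, map_zero C⟩

/-- Let `K` be a field and `A ∈ GL_n(K[t])` with `A^d = I` for
some positive integer `d` not divisible by the characteristic of `K`.  Then `A` is
conjugate over `K[t]` to a matrix with entries in `K` (an element of `GL_n(K)`). -/
theorem statement_12 (K : Type*) [Field K] (n d : ℕ) (hd : 0 < d)
    (hchar : ¬ (ringChar K ∣ d))
    (A : Matrix (Fin n) (Fin n) (Polynomial K)) (hA : IsUnit A)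
    (hAd : A ^ d = 1) :
    ∃ B : Matrix (Fin n) (Fin n) (Polynomial K),
      IsUnit B ∧
      ∃ A₀ : Matrix (Fin n) (Fin n) K,
        IsUnit A₀ ∧ B * A = (A₀.map (algebraMap K (Polynomial K))) * B := by
  let φ := Matrix.toLin' A
  have hsq : Squarefree (X ^ d - 1 : K[X]) :=
    (X_pow_sub_one_separable_iff.mpr fun h => hchar ((ringChar.spec K d).mp h)).squarefree
  have hφ : φ ^ d = 1 := by
    rw [← Matrix.toLin'_pow, hAd, Matrix.toLin'_one]; rfl
  have htors : Module.IsTorsionBy K[X][X] (Module.AEval' φ) ((X ^ d - 1 : K[X]).map C) := by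
    intro x
    obtain ⟨x, rfl⟩ := (Module.AEval'.of φ).surjective x
    simp [sub_smul, Module.AEval'.X_pow_smul_of, hφ]
  have : Module.IsTorsionFree K[X] (Module.AEval' φ) :=
    inferInstanceAs (Module.IsTorsionFree K[X] (Fin n → K[X]))
  obtain ⟨ι, _, b, hb⟩ := exists_basis_repr_X_smul_mem_of_squarefree hsq htors
  have := Fintype.ofFinite ι
  let std := Pi.basisFun K[X] (Fin n)
  let b₁ := b.map (Module.AEval'.of φ).symm
  let f := b₁.indexEquiv std
  let b' := b₁.reindex f
  have hb' (i j) : LinearMap.toMatrix b' b' φ i j ∈ Set.range (C : K → K[X]) := by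
    have := hb (f.symm i) (f.symm j)
    convert this using 1
    simp [LinearMap.toMatrix_apply, b', b₁, ← Module.AEval'.X_smul_of]
  choose A₀ hA₀ using hb'
  have hmap : (Matrix.of A₀).map (algebraMap K K[X]) = LinearMap.toMatrix b' b' φ :=
    Matrix.ext fun i j => hA₀ i j
  refine ⟨LinearMap.toMatrix std b' LinearMap.id, ?_, Matrix.of A₀, ?_, ?_⟩
  · rw [LinearMap.toMatrix_id_eq_basis_toMatrix]
    have := b'.invertibleToMatrix std
    exact isUnit_of_invertible _
  · have hu : IsUnit (LinearMap.toMatrix b' b' φ) :=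
      (IsUnit.of_pow_eq_one hφ hd.ne').map (LinearMap.toMatrixAlgEquiv b')
    rw [← hmap, Matrix.isUnit_iff_isUnit_det] at hu
    rw [Matrix.isUnit_iff_isUnit_det, ← isUnit_C, ← algebraMap_eq, RingHom.map_det]
    exact hu
  · have hA' : A = LinearMap.toMatrix std std φ := (LinearMap.toMatrix'_toLin' A).symm
    rw [hmap, ← LinearMap.toMatrix_comp]
    nth_rw 1 [hA']
    rw [← LinearMap.toMatrix_comp, LinearMap.id_comp, LinearMap.comp_id]
end

section
/- Let K be a field and let A = (a_{ij}) ∈ GL_n(K[X_1,...,X_n]) be a matrix in separated variables (a_{ij} ∈ K[X_j] for all i, j) such that A(0,...,0) = I_n. Then there is a permutation matrix P such that P^{−1}AP is unitriangular, i.e. upper triangular with all diagonal entries equal to 1. -/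
open MvPolynomial

/-- A relation on a finite type that is not well-founded has a nonempty set on which the relation
restricts to the graph of a permutation. -/
theorem exists_perm_unique_predecessor {ι : Type*} [Finite ι] [DecidableEq ι] {r : ι → ι → Prop}
    (hr : ¬ WellFounded r) :
    ∃ (S : Finset ι) (π : Equiv.Perm ι), S.Nonempty ∧ (∀ j ∉ S, π j = j) ∧
      ∀ j ∈ S, ∀ i ∈ S, r i j ↔ i = π j := by
  classical
  have := Fintype.ofFinite ι
  let p : Finset ι → Prop := fun S => S.Nonempty ∧ ∀ j ∈ S, ∃ i ∈ S, r i j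
  have hp : ∃ S, p S := by
    rw [WellFounded.wellFounded_iff_has_min] at hr
    push Not at hr
    obtain ⟨s, ⟨x, hx⟩, h⟩ := hr
    exact ⟨s.toFinset, ⟨x, by simpa using hx⟩, by simpa using h⟩
  obtain ⟨S, ⟨hS, hpred⟩, hmin⟩ := wellFounded_lt.has_min {S | p S} hp
  have himage : ∀ g : ι → ι, (∀ j ∈ S, g j ∈ S ∧ r (g j) j) → S.image g = S := by
    intro g hg
    have hsub : S.image g ⊆ S := Finset.image_subset_iff.2 fun j hj => (hg j hj).1
    by_contra hne
    refine hmin (S.image g) ⟨hS.image g, fun j hj => ?_⟩ (hsub.ssubset_of_ne hne)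
    exact ⟨g j, Finset.mem_image_of_mem g (hsub hj), (hg j (hsub hj)).2⟩
  have hinj : ∀ g : ι → ι, (∀ j ∈ S, g j ∈ S ∧ r (g j) j) → Set.InjOn g S := fun g hg =>
    Finset.card_image_iff.1 (by rw [himage g hg])
  choose! f hf using hpred
  have hπ : Function.Injective fun j => if j ∈ S then f j else j := by
    intro a b hab
    by_cases ha : a ∈ S <;> by_cases hb : b ∈ S <;> simp only [ha, hb, if_true, if_false] at hab
    · exact hinj f hf ha hb hab
    · exact absurd (hab ▸ (hf a ha).1) hb
    · exact absurd (hab ▸ (hf b hb).1) ha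
    · exact hab
  refine ⟨S, Equiv.ofBijective _ (Finite.injective_iff_bijective.1 hπ), hS,
    fun j hj => by simp [hj], fun j hj i hi => ?_⟩
  simp only [Equiv.ofBijective_apply, hj, if_true]
  refine ⟨fun hij => ?_, fun h => h ▸ (hf j hj).2⟩
  by_contra hne
  have hg : ∀ k ∈ S, Function.update f j i k ∈ S ∧ r (Function.update f j i k) k := by
    intro k hk
    rcases eq_or_ne k j with rfl | hkj
    · simpa using ⟨hi, hij⟩
    · simpa [hkj] using hf k hk
  obtain ⟨k, hk, hki⟩ := Finset.mem_image.1 ((himage f hf).symm ▸ hi)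
  have hkj : k ≠ j := by
    rintro rfl
    exact hne hki.symm
  exact hkj (hinj _ hg hk hj (by simp [hkj, hki]))

/-- Over a domain, if all nonempty principal minors of `N` vanish (each written as the determinant
of the matrix whose columns outside `S` are standard basis vectors), then the digraph of nonzero
entries of `N` has no cycles. -/
theorem Matrix.wellFounded_ne_zero_of_principal_minors_eq_zero {ι R : Type*} [Fintype ι]
    [DecidableEq ι] [CommRing R] [IsDomain R] (N : Matrix ι ι R)
    (hN : ∀ S : Finset ι, S.Nonempty →
      (Matrix.of fun i j => if j ∈ S then N i j else (1 : Matrix ι ι R) i j).det = 0) :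
    WellFounded fun i j => N i j ≠ 0 := by
  by_contra hr
  obtain ⟨S, π, hS, hfix, hπ⟩ := exists_perm_unique_predecessor hr
  have hmem : ∀ σ : Equiv.Perm ι, (∀ j ∉ S, σ j = j) → ∀ j ∈ S, σ j ∈ S := by
    intro σ hσ j hj
    by_contra h
    exact h ((σ.injective (hσ _ h)).symm ▸ hj)
  have hdet := hN S hS
  rw [Matrix.det_apply', Finset.sum_eq_single π] at hdet
  · refine mul_ne_zero ?_ (Finset.prod_ne_zero_iff.2 fun j _ => ?_) hdet
    · rcases Int.units_eq_one_or (Equiv.Perm.sign π) with h | h <;> simp [h]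
    · by_cases hj : j ∈ S
      · simpa [hj] using (hπ j hj _ (hmem π hfix j hj)).2 rfl
      · simp [hj, hfix j hj]
  · intro σ _ hne
    refine mul_eq_zero_of_right _ ?_
    by_contra hprod
    replace hprod := Finset.prod_ne_zero_iff.1 hprod
    have hσ : ∀ j ∉ S, σ j = j := fun j hj => by
      simpa [hj, Matrix.one_apply] using hprod j (Finset.mem_univ j)
    refine hne (Equiv.ext fun j => ?_)
    by_cases hj : j ∈ S
    · exact (hπ j hj _ (hmem σ hσ j hj)).1 (by simpa [hj] using hprod j (Finset.mem_univ j))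
    · rw [hσ j hj, hfix j hj]
  · simp

/-- A well-founded relation on `Fin n` can be topologically sorted. -/
theorem WellFounded.exists_perm_not_rel_of_le {n : ℕ} {r : Fin n → Fin n → Prop}
    (hr : WellFounded r) : ∃ σ : Equiv.Perm (Fin n), ∀ i j, j ≤ i → ¬ r (σ i) (σ j) := by
  have : IsWellFounded (Fin n) r := ⟨hr⟩
  refine ⟨Tuple.sort (IsWellFounded.rank r), fun i j hij h => ?_⟩
  exact (IsWellFounded.rank_lt_of_rel h).not_ge (Tuple.monotone_sort (IsWellFounded.rank r) hij)

namespace MvPolynomial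

variable {K ι : Type*} [CommRing K] [DecidableEq ι]

/-- The endomorphism of the polynomial ring that sets the variables outside `S` to zero. -/
noncomputable def killOutside (K : Type*) [CommRing K] (S : Finset ι) :
    MvPolynomial ι K →ₐ[K] MvPolynomial ι K :=
  aeval fun j => if j ∈ S then X j else 0

theorem killOutside_of_mem {S : Finset ι} {j : ι} (hj : j ∈ S) {p : MvPolynomial ι K}
    (hp : p ∈ supported K ({j} : Set ι)) : killOutside K S p = p := by
  induction hp using Algebra.adjoin_induction with
  | mem x hx =>
    obtain ⟨k, rfl, rfl⟩ := hx
    simp [killOutside, hj]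
  | algebraMap r => simp
  | add x y _ _ hx hy => rw [map_add, hx, hy]
  | mul x y _ _ hx hy => rw [map_mul, hx, hy]

theorem killOutside_of_notMem {S : Finset ι} {j : ι} (hj : j ∉ S) {p : MvPolynomial ι K}
    (hp : p ∈ supported K ({j} : Set ι)) :
    killOutside K S p = C (eval (fun _ => (0 : K)) p) := by
  induction hp using Algebra.adjoin_induction with
  | mem x hx =>
    obtain ⟨k, rfl, rfl⟩ := hx
    simp [killOutside, hj]
  | algebraMap r => simp [algebraMap_eq]
  | add x y _ _ hx hy => simp only [map_add, hx, hy]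
  | mul x y _ _ hx hy => simp only [map_mul, hx, hy]

variable {A : Matrix ι ι (MvPolynomial ι K)}

theorem killOutside_entry_of_notMem {S : Finset ι}
    (hsep : ∀ i j, A i j ∈ supported K ({j} : Set ι))
    (h0 : A.map (eval (fun _ => (0 : K))) = 1) {j : ι} (hj : j ∉ S) (i : ι) :
    killOutside K S (A i j) = (1 : Matrix ι ι (MvPolynomial ι K)) i j := by
  rw [killOutside_of_notMem hj (hsep i j)]
  have := congrFun (congrFun h0 i) j
  rw [Matrix.map_apply] at this
  rw [this, Matrix.one_apply, Matrix.one_apply]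
  split_ifs <;> simp

variable [Fintype ι]

/-- For a matrix in separated variables with constant determinant and value `1` at the origin,
replacing the columns in `T` by those of `A - 1` again gives a constant determinant, which is zero
as soon as `T` is nonempty. -/
theorem det_sub_one_columns (hsep : ∀ i j, A i j ∈ supported K ({j} : Set ι))
    (h0 : A.map (eval (fun _ => (0 : K))) = 1) {c : K} (hc : A.det = C c) (T : Finset ι) :
    (Matrix.of fun i j => if j ∈ T then (A - 1) i j else A i j).det =
      if T.Nonempty then 0 else C c := by
  induction T using Finset.induction_on with
  | empty => simpa using! hc
  | insert j T hj ih =>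
    set M := Matrix.of fun i k => if k ∈ T then (A - 1) i k else A i k with hM
    have hconst : killOutside K ({j}ᶜ : Finset ι) M.det = M.det := by
      rw [ih]
      split_ifs <;> simp [killOutside]
    have hkill : killOutside K ({j}ᶜ : Finset ι) M.det =
        (M.updateCol j fun i => (1 : Matrix ι ι (MvPolynomial ι K)) i j).det := by
      rw [AlgHom.map_det]
      congr 1
      ext1 i k
      rcases eq_or_ne k j with rfl | hkj
      · simp only [AlgHom.mapMatrix_apply, Matrix.map_apply, hM, Matrix.of_apply, hj, if_false,
          Matrix.updateCol_self]
        exact killOutside_entry_of_notMem hsep h0 (by simp) i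
      · have hA : killOutside K ({j}ᶜ : Finset ι) (A i k) = A i k :=
          killOutside_of_mem (by simpa using hkj) (hsep i k)
        simp only [AlgHom.mapMatrix_apply, Matrix.map_apply, hM, Matrix.of_apply,
          Matrix.updateCol_ne hkj, Matrix.sub_apply, Matrix.one_apply]
        split_ifs <;> simp [hA]
    have hadd : M.det = (M.updateCol j fun i => (A - 1) i j).det +
        (M.updateCol j fun i => (1 : Matrix ι ι (MvPolynomial ι K)) i j).det := by
      rw [← Matrix.det_updateCol_add]
      congr 1
      ext1 i k
      rcases eq_or_ne k j with rfl | hkj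
      · simp [hM, hj]
      · simp [Matrix.updateCol_ne hkj]
    rw [← hkill, hconst, right_eq_add] at hadd
    rw [if_pos (Finset.insert_nonempty j T), ← hadd]
    congr 1
    ext1 i k
    rcases eq_or_ne k j with rfl | hkj
    · simp
    · simp [hkj, hM]

theorem det_principal_sub_one_eq_zero (hsep : ∀ i j, A i j ∈ supported K ({j} : Set ι))
    (h0 : A.map (eval (fun _ => (0 : K))) = 1) {c : K} (hc : A.det = C c) {S : Finset ι}
    (hS : S.Nonempty) :
    (Matrix.of fun i j =>
      if j ∈ S then (A - 1) i j else (1 : Matrix ι ι (MvPolynomial ι K)) i j).det = 0 := by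
  have h := congrArg (killOutside K S) (det_sub_one_columns hsep h0 hc S)
  rw [if_pos hS, map_zero, AlgHom.map_det] at h
  rw [← h]
  congr 1
  ext1 i j
  simp only [AlgHom.mapMatrix_apply, Matrix.map_apply, Matrix.of_apply]
  split_ifs with hj
  · rw [Matrix.sub_apply, map_sub, killOutside_of_mem hj (hsep i j), Matrix.one_apply]
    split_ifs <;> simp
  · exact (killOutside_entry_of_notMem hsep h0 hj i).symm

end MvPolynomial

/-- Let `A ∈ GL_n(K[X_1,…,X_n])` be a matrix in separated
variables (the entry `a_ij` lies in `K[X_j]`) with `A(0,…,0) = I_n`.  Then after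
conjugation by a permutation matrix `A` is unitriangular: upper triangular with
all diagonal entries equal to `1`. -/
theorem statement_14 (K : Type*) [Field K] (n : ℕ)
    (A : Matrix (Fin n) (Fin n) (MvPolynomial (Fin n) K))
    (hA : IsUnit A)
    (hsep : ∀ i j, A i j ∈ MvPolynomial.supported K ({j} : Set (Fin n)))
    (h0 : A.map (MvPolynomial.eval (fun _ : Fin n => (0 : K))) = 1) :
    ∃ σ : Equiv.Perm (Fin n),
      (∀ i j : Fin n, j < i → A.submatrix σ σ i j = 0) ∧
      (∀ i : Fin n, A.submatrix σ σ i i = 1) := by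
  obtain ⟨c, -, hc⟩ := MvPolynomial.isUnit_iff_eq_C_of_isReduced.1 (A.isUnit_iff_isUnit_det.1 hA)
  obtain ⟨σ, hσ⟩ := ((A - 1).wellFounded_ne_zero_of_principal_minors_eq_zero fun _ hS =>
    det_principal_sub_one_eq_zero hsep h0 hc hS).exists_perm_not_rel_of_le
  simp only [not_not, Matrix.sub_apply, sub_eq_zero] at hσ
  refine ⟨σ, fun i j hij => ?_, fun i => ?_⟩
  · rw [Matrix.submatrix_apply, hσ i j hij.le, Matrix.one_apply_ne (σ.injective.ne hij.ne')]
  · rw [Matrix.submatrix_apply, hσ i i le_rfl, Matrix.one_apply_eq]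
end

section
/- Let K be a field of characteristic zero and let f ∈ GA_n(K) be a polynomial automorphism without mixed terms whose linear part equals the identity. Then there exists a permutation π of the variables X_1,...,X_n such that π^{−1}∘f∘π is unitriangular. Furthermore, if K has characteristic p > 0, then there exists a permutation π of the variables such that π^{−1}∘f∘π lies in BA_n^{(1)}(K) + (K[X_1^p] + ... + K[X_n^p])^n, i.e. differs from a unitriangular automorphism by a polynomial map whose components are polynomials in the p-th powers of the variables. -/
open MvPolynomial

/-- `f` is an invertible polynomial map (polynomial automorphism). -/
def IsPolyAut {K : Type*} [CommSemiring K] {n : ℕ}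
    (f : Fin n → MvPolynomial (Fin n) K) : Prop :=
  ∃ g : Fin n → MvPolynomial (Fin n) K,
    (∀ i, bind₁ g (f i) = X i) ∧ (∀ i, bind₁ f (g i) = X i)

/-- A polynomial map is without mixed terms if each component lies in
`K[X_1] + ⋯ + K[X_n]`. -/
def NoMixedTerms {K : Type*} [CommSemiring K] {n : ℕ}
    (f : Fin n → MvPolynomial (Fin n) K) : Prop :=
  ∀ i, f i ∈ ⨆ j : Fin n,
    Subalgebra.toSubmodule (MvPolynomial.supported K ({j} : Set (Fin n)))

theorem exists_finset_injOn_of_not_wellFounded_swap {α : Type*} [Fintype α] {r : α → α → Prop}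
    (hr : ¬ WellFounded (Function.swap r)) :
    ∃ (S : Finset α) (s : α → α), S.Nonempty ∧ Set.InjOn s S ∧
      ∀ i ∈ S, s i ∈ S ∧ ∀ j ∈ S, r i j ↔ j = s i := by
  classical
  let P : Finset α → Prop := fun S => S.Nonempty ∧ ∀ i ∈ S, ∃ j ∈ S, r i j
  have hP : ∃ S, P S := by
    rw [WellFounded.wellFounded_iff_has_min] at hr
    push Not at hr
    obtain ⟨S, hS, h⟩ := hr
    refine ⟨S.toFinite.toFinset, by simpa using hS, fun i hi => ?_⟩
    obtain ⟨j, hj, hij⟩ := h i (by simpa using hi)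
    exact ⟨j, by simpa using hj, hij⟩
  obtain ⟨S, hS, hmin⟩ := WellFounded.has_min (measure Finset.card).wf {S | P S} hP
  have hinj : ∀ t : α → α, (∀ i ∈ S, t i ∈ S ∧ r i (t i)) → Set.InjOn t S := by
    intro t ht
    rw [← Finset.card_image_iff]
    refine le_antisymm Finset.card_image_le (not_lt.1 (hmin (S.image t) ⟨hS.1.image t, ?_⟩))
    intro i hi
    obtain ⟨k, hk, rfl⟩ := Finset.mem_image.1 hi
    exact ⟨t (t k), Finset.mem_image_of_mem t (ht k hk).1, (ht _ (ht k hk).1).2⟩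
  have hs : ∀ i, ∃ j, i ∈ S → j ∈ S ∧ r i j := fun i => by
    by_cases hi : i ∈ S
    · obtain ⟨j, hj⟩ := hS.2 i hi
      exact ⟨j, fun _ => hj⟩
    · exact ⟨i, fun h => (hi h).elim⟩
  choose s hs using hs
  have hsinj := hinj s hs
  refine ⟨S, s, hS.1, hsinj, fun i hi => ⟨(hs i hi).1, fun j hj => ⟨fun hij => ?_, ?_⟩⟩⟩
  · obtain ⟨k, hk, rfl⟩ : ∃ k ∈ S, s k = j :=
      Finset.surjOn_of_injOn_of_card_le s (fun i hi => (hs i hi).1) hsinj le_rfl hj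
    by_contra hne
    have hki : k ≠ i := fun h => hne (by rw [h])
    have ht := hinj (Function.update s i (s k)) fun l hl => by
      by_cases hli : l = i
      · subst hli
        simpa using ⟨hj, hij⟩
      · simpa [hli] using hs l hl
    exact hki (ht hk hi (by simp [hki]))
  · rintro rfl
    exact (hs i hi).2

theorem exists_perm_lt_of_wellFounded_swap {n : ℕ} {r : Fin n → Fin n → Prop}
    (hr : WellFounded (Function.swap r)) :
    ∃ π : Equiv.Perm (Fin n), ∀ i j, r i j → π i < π j := by
  have : IsWellFounded (Fin n) (Function.swap r) := ⟨hr⟩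
  let d : Fin n → Ordinalᵒᵈ := fun i => OrderDual.toDual (IsWellFounded.rank (Function.swap r) i)
  refine ⟨(Tuple.sort d)⁻¹, fun i j hij => ?_⟩
  have hd : d i < d j := OrderDual.toDual_lt_toDual.2 (IsWellFounded.rank_lt_of_rel hij)
  by_contra! h
  have hle : d j ≤ d i := by simpa using Tuple.monotone_sort d h
  exact hle.not_gt hd

theorem eq_zero_of_sum_mul_aeval_pderiv_eq_zero {K L σ : Type*} [CommRing K] [CommRing L]
    [Algebra K L] [Fintype σ] {f g : σ → MvPolynomial σ K} (hg : ∀ i, bind₁ f (g i) = X i)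
    (x v : σ → L) (hv : ∀ i, ∑ j, v j * aeval x (pderiv j (f i)) = 0) (i : σ) : v i = 0 := by
  classical
  have key : ∀ q : MvPolynomial σ K, ∑ j, v j * aeval x (pderiv j (bind₁ f q)) = 0 := by
    intro q
    induction q using MvPolynomial.induction_on with
    | C a => simp
    | add p q hp hq => simp [mul_add, Finset.sum_add_distrib, hp, hq]
    | mul_X p i hp =>
      have : ∀ j, v j * aeval x (pderiv j (bind₁ f (p * X i))) =
          aeval x (bind₁ f p) * (v j * aeval x (pderiv j (f i))) +
            aeval x (f i) * (v j * aeval x (pderiv j (bind₁ f p))) := fun j => by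
        simp only [map_mul, bind₁_X_right, Derivation.leibniz, smul_eq_mul, map_add]
        ring
      simp only [this, Finset.sum_add_distrib, ← Finset.mul_sum, hv, hp, mul_zero, add_zero]
  have := key (g i)
  rw [hg] at this
  simpa [pderiv_X, Pi.single_apply, apply_ite] using this

theorem exists_aeval_eq_neg_one {K L : Type*} [Field K] [Field L] [IsAlgClosed L] [Algebra K L]
    {a : Polynomial K} (ha : a ≠ 0) (h0 : a.coeff 0 = 0) : ∃ t : L, Polynomial.aeval t a = -1 := by
  obtain ⟨t, ht⟩ := IsAlgClosed.exists_aeval_eq_zero L (a + 1) fun hdeg => ha <| by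
    have := Polynomial.eq_C_of_degree_eq_zero hdeg
    rw [Polynomial.coeff_add, h0, Polynomial.coeff_one_zero, zero_add, map_one] at this
    simpa using this
  exact ⟨t, by rw [map_add, map_one] at ht; exact eq_neg_of_add_eq_zero_left ht⟩

theorem wellFounded_swap_derivative_ne_zero {K : Type*} [Field K] {n : ℕ}
    {f g : Fin n → MvPolynomial (Fin n) K} (hg : ∀ i, bind₁ f (g i) = X i)
    {h : Fin n → Fin n → Polynomial K}
    (hf : ∀ i, f i = X i + ∑ j, Polynomial.aeval (X j) (h i j))
    (h1 : ∀ i j, (h i j).coeff 1 = 0) :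
    WellFounded (Function.swap fun i j => (h i j).derivative ≠ 0) := by
  classical
  by_contra hwf
  obtain ⟨S, s, hS, hinj, hs⟩ := exists_finset_injOn_of_not_wellFounded_swap hwf
  let L := AlgebraicClosure K
  have h0 : ∀ i j, (h i j).derivative.coeff 0 = 0 := fun i j => by
    simp [Polynomial.coeff_derivative, h1]
  have hx : ∀ j, ∃ t : L, (j ∉ S → t = 0) ∧
      ∀ i ∈ S, s i = j → Polynomial.aeval t (h i j).derivative = -1 := by
    intro j
    by_cases hj : ∃ i ∈ S, s i = j
    · obtain ⟨i, hi, rfl⟩ := hj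
      obtain ⟨t, ht⟩ := exists_aeval_eq_neg_one (L := L)
        (((hs i hi).2 _ (hs i hi).1).2 rfl) (h0 i (s i))
      refine ⟨t, fun h => (h (hs i hi).1).elim, fun k hk hki => ?_⟩
      rwa [hinj hk hi hki]
    · exact ⟨0, fun _ => rfl, fun i hi hij => (hj ⟨i, hi, hij⟩).elim⟩
  choose x hx0 hx1 using hx
  let w : Fin n → L := fun i => ∑ j ∈ S, Polynomial.aeval (x j) (h i j).derivative
  let v : Fin n → L := fun i => if i ∈ S then 1 else - w i
  have hw : ∀ i ∈ S, w i = -1 := fun i hi => by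
    rw [← hx1 (s i) i hi rfl]
    refine Finset.sum_eq_single_of_mem _ (hs i hi).1 fun j hj hne => ?_
    have : (h i j).derivative = 0 := by
      by_contra hne'
      exact hne (((hs i hi).2 j hj).1 hne')
    simp [this]
  have hpd : ∀ i j, aeval x (pderiv j (f i)) =
      (if i = j then 1 else 0) + Polynomial.aeval (x j) (h i j).derivative := by
    intro i j
    simp only [hf, map_add, map_sum, Derivation.map_aeval, pderiv_X, smul_eq_mul,
      ← Polynomial.aeval_algHom_apply, aeval_X, Pi.single_apply, apply_ite (aeval x), map_one,
      map_zero, mul_ite, mul_one, mul_zero]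
    simp
  have hv : ∀ i, ∑ j, v j * aeval x (pderiv j (f i)) = 0 := by
    intro i
    have hsum : ∑ j, v j * Polynomial.aeval (x j) (h i j).derivative = w i := by
      rw [← Finset.sum_subset (Finset.subset_univ S)]
      · exact Finset.sum_congr rfl fun j hj => by simp [v, hj]
      · intro j _ hj
        rw [hx0 j hj, ← Polynomial.coeff_zero_eq_aeval_zero', h0]
        simp
    simp only [hpd, mul_add, Finset.sum_add_distrib, hsum, mul_ite, mul_one, mul_zero,
      Finset.sum_ite_eq, Finset.mem_univ, if_true]
    by_cases hi : i ∈ S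
    · simp [v, hi, hw i hi]
    · simp [v, hi]
  obtain ⟨i, hi⟩ := hS
  have := eq_zero_of_sum_mul_aeval_pderiv_eq_zero hg x v hv i
  simp [v, hi] at this

theorem coeff_single_one_aeval_X {K σ : Type*} [CommRing K] [DecidableEq σ] (q : Polynomial K)
    (j k : σ) :
    coeff (Finsupp.single k 1) (Polynomial.aeval (X j : MvPolynomial σ K) q) =
      if j = k then q.coeff 1 else 0 := by
  rw [Polynomial.aeval_eq_sum_range, coeff_sum]
  simp only [coeff_smul, coeff_X_pow, smul_eq_mul]
  have : ∀ m, (Finsupp.single j m = Finsupp.single k 1) ↔ (m = 1 ∧ j = k) := fun m => by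
    rw [Finsupp.single_eq_single_iff]
    simp [and_comm]
  simp only [this, ite_and, mul_ite, mul_one, mul_zero]
  rw [Finset.sum_ite_eq']
  split_ifs with h1 h2 <;> try rfl
  rw [Polynomial.coeff_eq_zero_of_natDegree_lt]
  simpa using h1

theorem NoMixedTerms.exists_eq_sum {K : Type*} [CommRing K] {n : ℕ}
    {f : Fin n → MvPolynomial (Fin n) K} (hf : NoMixedTerms f) (i : Fin n) :
    ∃ q : Fin n → Polynomial K, f i = ∑ j, Polynomial.aeval (X j) (q j) := by
  obtain ⟨m, hm⟩ := (Submodule.mem_iSup_iff_exists_finsupp _ _).1 (hf i)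
  have hq : ∀ j, ∃ q : Polynomial K, Polynomial.aeval (X j) q = m j := fun j => by
    have := hm.1 j
    rwa [Subalgebra.mem_toSubmodule, supported_eq_adjoin_X, Set.image_singleton,
      Algebra.adjoin_singleton_eq_range_aeval] at this
  choose q hq using hq
  refine ⟨q, ?_⟩
  rw [← hm.2, Finsupp.sum_fintype _ _ (fun _ => rfl)]
  exact Finset.sum_congr rfl fun j _ => (hq j).symm

theorem NoMixedTerms.exists_eq_X_add_sum {K : Type*} [CommRing K] {n : ℕ}
    {f : Fin n → MvPolynomial (Fin n) K} (hf : NoMixedTerms f)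
    (hlin : ∀ i, homogeneousComponent 1 (f i) = X i) :
    ∃ h : Fin n → Fin n → Polynomial K,
      (∀ i, f i = X i + ∑ j, Polynomial.aeval (X j) (h i j)) ∧ ∀ i j, (h i j).coeff 1 = 0 := by
  choose q hq using hf.exists_eq_sum
  refine ⟨fun i j => q i j - if i = j then Polynomial.X else 0, fun i => ?_, fun i j => ?_⟩
  · simp only [map_sub, Finset.sum_sub_distrib, ← hq]
    simp [apply_ite]
  · have h1 := congrArg (coeff (Finsupp.single j 1)) (hlin i)
    rw [coeff_homogeneousComponent, if_pos (by simp), hq, coeff_sum] at h1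
    simp only [coeff_single_one_aeval_X, Finset.sum_ite_eq', Finset.mem_univ, if_true] at h1
    rw [Polynomial.coeff_sub, h1]
    simp [MvPolynomial.coeff_X, Finsupp.single_left_inj, apply_ite (Polynomial.coeff · 1)]

theorem RingHom.injective_of_surjective_of_isNoetherianRing {R : Type*} [CommRing R]
    [IsNoetherianRing R] (φ : R →+* R) (hφ : Function.Surjective φ) : Function.Injective φ := by
  have hmono : Monotone fun m : ℕ => RingHom.ker (φ ^ m) := monotone_nat_of_le_succ fun m x hx => by
    rw [RingHom.mem_ker, RingHom.coe_pow] at hx ⊢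
    rw [Function.iterate_succ_apply', hx, map_zero]
  obtain ⟨m, hm⟩ := monotone_stabilizes_iff_noetherian.2 ‹IsNoetherianRing R› ⟨_, hmono⟩
  rw [injective_iff_map_eq_zero]
  intro x hx
  obtain ⟨y, rfl⟩ := hφ.iterate m x
  have hy : y ∈ RingHom.ker (φ ^ (m + 1)) := by
    rwa [RingHom.mem_ker, RingHom.coe_pow, Function.iterate_succ_apply']
  have hm' : RingHom.ker (φ ^ m) = RingHom.ker (φ ^ (m + 1)) := hm (m + 1) m.le_succ
  rwa [← hm', RingHom.mem_ker, RingHom.coe_pow] at hy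

theorem isPolyAut_of_sub_X_mem_supported {K : Type*} [Field K] {n : ℕ}
    {u : Fin n → MvPolynomial (Fin n) K}
    (hu : ∀ i, u i - X i ∈ supported K {j : Fin n | i < j}) : IsPolyAut u := by
  have hX : ∀ i, X i ∈ (bind₁ u).range := by
    intro i
    induction i using WellFoundedGT.induction with
    | _ i ih =>
      have hle : supported K {j : Fin n | i < j} ≤ (bind₁ u).range := by
        rw [supported_eq_adjoin_X]
        refine Algebra.adjoin_le ?_
        rintro _ ⟨j, hj, rfl⟩
        exact ih j hj
      have hui : u i ∈ (bind₁ u).range := ⟨X i, by simp⟩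
      simpa using sub_mem hui (hle (hu i))
  have hsurj : Function.Surjective (bind₁ u) := by
    rw [← AlgHom.range_eq_top, eq_top_iff, ← adjoin_range_X]
    refine Algebra.adjoin_le ?_
    rintro _ ⟨j, rfl⟩
    exact hX j
  have hinj : Function.Injective (bind₁ u) :=
    (bind₁ u).toRingHom.injective_of_surjective_of_isNoetherianRing hsurj
  choose g hg using hX
  have hg' : ∀ i, bind₁ u (g i) = X i := hg
  refine ⟨g, fun i => hinj ?_, hg'⟩
  simp only [bind₁_bind₁, bind₁_X_right, hg', bind₁_X_left, AlgHom.id_apply]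

theorem aeval_X_mem_supported {K σ : Type*} [CommSemiring K] (q : Polynomial K) {s : Set σ}
    {j : σ} (hj : j ∈ s) : Polynomial.aeval (X j : MvPolynomial σ K) q ∈ supported K s :=
  Algebra.adjoin_mono (Set.singleton_subset_iff.2 (Set.mem_image_of_mem X hj)) <| by
    rw [Algebra.adjoin_singleton_eq_range_aeval]
    exact ⟨q, rfl⟩

/-- Let `f ∈ GA_n(K)` be an automorphism without mixed terms
whose linear part is the identity.  If `char K = 0` there is a permutation `π` of
the variables with `π⁻¹ ∘ f ∘ π` unitriangular; if `char K = p > 0` there is a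
permutation `π` with `π⁻¹ ∘ f ∘ π ∈ BA_n^{(1)}(K) + (K[X_1^p] + ⋯ + K[X_n^p])^n`. -/
theorem statement_15 (K : Type*) [Field K] (n : ℕ)
    (f : Fin n → MvPolynomial (Fin n) K)
    (hf : IsPolyAut f) (hmix : NoMixedTerms f)
    (hlin : ∀ i, homogeneousComponent 1 (f i) = X i) :
    (CharZero K →
      ∃ π : Equiv.Perm (Fin n), ∀ i : Fin n,
        rename (π : Fin n → Fin n) (f (π⁻¹ i)) - X i ∈
          MvPolynomial.supported K {j : Fin n | i < j}) ∧
    (∀ p : ℕ, p.Prime → CharP K p →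
      ∃ (π : Equiv.Perm (Fin n)) (u : Fin n → MvPolynomial (Fin n) K),
        IsPolyAut u ∧
        (∀ i : Fin n, u i - X i ∈ MvPolynomial.supported K {j : Fin n | i < j}) ∧
        (∀ i : Fin n,
          rename (π : Fin n → Fin n) (f (π⁻¹ i)) - u i ∈
            ⨆ j : Fin n, Subalgebra.toSubmodule
              (Algebra.adjoin K {(X j : MvPolynomial (Fin n) K) ^ p}))) := by
  classical
  obtain ⟨h, hfh, h1⟩ := hmix.exists_eq_X_add_sum hlin
  obtain ⟨g, -, hg⟩ := hf
  obtain ⟨π, hπ⟩ := exists_perm_lt_of_wellFounded_swap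
    (wellFounded_swap_derivative_ne_zero hg hfh h1)
  have hren : ∀ i, rename π (f (π⁻¹ i)) =
      X i + ∑ j, Polynomial.aeval (X (π j)) (h (π⁻¹ i) j) := fun i => by
    simp [hfh, ← Polynomial.aeval_algHom_apply]
  have hmem : ∀ i j, (h (π⁻¹ i) j).derivative ≠ 0 →
      Polynomial.aeval (X (π j)) (h (π⁻¹ i) j) ∈ supported K {j : Fin n | i < j} :=
    fun i j hd => aeval_X_mem_supported _ (by simpa using hπ _ _ hd)
  refine ⟨fun _ => ⟨π, fun i => ?_⟩, fun p hp _ => ?_⟩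
  · rw [hren, add_sub_cancel_left]
    refine sum_mem fun j _ => ?_
    by_cases hd : (h (π⁻¹ i) j).derivative = 0
    · rw [Polynomial.eq_C_of_derivative_eq_zero hd, Polynomial.aeval_C]
      exact algebraMap_mem _ _
    · exact hmem i j hd
  · have : Fact p.Prime := ⟨hp⟩
    let u : Fin n → MvPolynomial (Fin n) K := fun i => X i + ∑ j,
      if (h (π⁻¹ i) j).derivative = 0 then 0 else Polynomial.aeval (X (π j)) (h (π⁻¹ i) j)
    have hu : ∀ i, u i - X i ∈ supported K {j : Fin n | i < j} := fun i => by
      simp only [u, add_sub_cancel_left]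
      refine sum_mem fun j _ => ?_
      split_ifs with hd
      · exact zero_mem _
      · exact hmem i j hd
    refine ⟨π, u, isPolyAut_of_sub_X_mem_supported hu, hu, fun i => ?_⟩
    simp only [hren, u, add_sub_add_left_eq_sub, ← Finset.sum_sub_distrib]
    refine sum_mem fun j _ => ?_
    split_ifs with hd
    · refine Submodule.mem_iSup_of_mem (π j) ?_
      rw [sub_zero, ← Polynomial.expand_contract p hd hp.ne_zero, Polynomial.expand_aeval,
        Subalgebra.mem_toSubmodule, Algebra.adjoin_singleton_eq_range_aeval]
      exact ⟨_, rfl⟩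
    · rw [sub_self]
      exact zero_mem _
end
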